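/- If isBST t holds and k ∈ Dom t, then for every x : ℤ, Map (update t k d) x = if x = k then some d else Map t x; i.e. the map represented by the tree after the update is the original map overridden by {k ↦ d} (this is the data-structure content of the specification of the running BST-update program). -/

import Mathlib

inductive BTree where
  | leaf : BTree
  | node : BTree → ℤ → ℤ → BTree → BTree
deriving DecidableEq

open BTree

def Dom : BTree → Set ℤ
  | leaf => ∅
  | node l k _ r => {k} ∪ Dom l ∪ Dom r

def isBST : BTree → Prop
  | leaf => True
  | node l k _ r => isBST l ∧ isBST r ∧ (∀ y ∈ Dom l, y < k) ∧ (∀ y ∈ Dom r, k < y)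

def Map : BTree → ℤ → Option ℤ
  | leaf, _ => none
  | node l k d r, x =>
      (Map r x).orElse fun _ =>
        (Map l x).orElse fun _ =>
          if x = k then some d else none

def update : BTree → ℤ → ℤ → BTree
  | leaf, _, _ => leaf
  | node l k0 d0 r, k, d =>
      if k = k0 then node l k0 d r
      else if k < k0 then node (update l k d) k0 d0 r
      else node l k0 d0 (update r k d)

theorem map_eq_none_of_notMem_dom (t : BTree) (x : ℤ) (hx : x ∉ Dom t) : Map t x = none := by
  induction t with
  | leaf => rfl
  | node l k d r ihl ihr =>
    simp only [Dom, Set.mem_union, Set.mem_singleton_iff, not_or] at hx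
    simp [Map, ihl hx.1.2, ihr hx.2, hx.1.1]

theorem map_update (t : BTree) (k d : ℤ)
    (hbst : isBST t) (hk : k ∈ Dom t) :
    ∀ x : ℤ, Map (update t k d) x =
      if x = k then some d else Map t x := by
  intro x
  induction t with
  | leaf => exact absurd hk (Set.notMem_empty k)
  | node l k₀ d₀ r ihl ihr =>
    obtain ⟨hl, hr, hlt, hgt⟩ := hbst
    simp only [Dom, Set.mem_union, Set.mem_singleton_iff] at hk
    rcases lt_trichotomy k k₀ with h | rfl | h
    · have hkr : k ∉ Dom r := fun hm => (h.trans (hgt k hm)).false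
      have hkl : k ∈ Dom l := by simpa [h.ne, hkr] using hk
      simp only [update, if_neg h.ne, if_pos h, Map, ihl hl hkl]
      split_ifs with hxk <;> simp_all [map_eq_none_of_notMem_dom]
    · have hkl : k ∉ Dom l := fun hm => (hlt k hm).false
      have hkr : k ∉ Dom r := fun hm => (hgt k hm).false
      simp only [update, if_true, Map]
      split_ifs with hxk <;> simp_all [map_eq_none_of_notMem_dom]
    · have hkl : k ∉ Dom l := fun hm => (h.trans (hlt k hm)).false
      have hkr : k ∈ Dom r := by simpa [h.ne', hkl] using hk
      simp only [update, if_neg h.ne', if_neg h.not_gt, Map, ihr hr hkr]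
      split_ifs with hxk <;> simp_all
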